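/- Each of the maps d₁, d₂, d₃ maps S^c into S^c and is a derivation of the algebra (S^c, ★): for j = 1, 2, 3 and all Φ, Ψ ∈ S^c, d_j(Φ★Ψ) = d_j(Φ)★Ψ + Φ★d_j(Ψ). -/

import Mathlib

open MeasureTheory Complex

noncomputable section

/-- `e x = exp (2 π i x)`. -/
def expi (x : ℝ) : ℂ := Complex.exp (2 * Real.pi * Complex.I * x)

/-- Partial derivative in the first variable. -/
def pdX (f : ℝ → ℝ → ℂ) : ℝ → ℝ → ℂ := fun x y => deriv (fun x' => f x' y) x

/-- Partial derivative in the second variable. -/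
def pdY (f : ℝ → ℝ → ℂ) : ℝ → ℝ → ℂ := fun x y => deriv (fun y' => f x y') y

/-- The space `S^c`: smooth functions on `ℝ × 𝕋 × ℤ` (a function on the torus `𝕋`
is identified with a `1`-periodic function on `ℝ`) satisfying the quasi-periodicity
relation `Φ(x+k,y,p) = e(ckpy) Φ(x,y,p)` for `k ∈ ℤ`, together with the
Schwartz-type bounds: for every polynomial `P` on `ℤ`, all partial derivatives
`X̃ = ∂^{m+n}/∂x^m ∂y^n` and every compact `K ⊆ ℝ × 𝕋`, the function
`P(p)(X̃Φ)(x,y,p)` is bounded on `K × ℤ`. -/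
def IsSc (c : ℕ) (Φ : ℝ → ℝ → ℤ → ℂ) : Prop :=
  (∀ p : ℤ, ContDiff ℝ (⊤ : ℕ∞) (fun xy : ℝ × ℝ => Φ xy.1 xy.2 p)) ∧
  (∀ (x y : ℝ) (p : ℤ), Φ x (y + 1) p = Φ x y p) ∧
  (∀ (k : ℤ) (x y : ℝ) (p : ℤ),
    Φ (x + k) y p = expi ((c : ℝ) * (k : ℝ) * (p : ℝ) * y) * Φ x y p) ∧
  (∀ (P : Polynomial ℤ) (m n : ℕ) (K : Set (ℝ × ℝ)), IsCompact K →
    ∃ C : ℝ, ∀ (x y : ℝ) (p : ℤ), (x, y) ∈ K →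
      ‖((P.eval p : ℤ) : ℂ) * pdX^[m] (pdY^[n] (fun x' y' => Φ x' y' p)) x y‖ ≤ C)

/-- The product `★` of the quantum Heisenberg manifold. -/
def starProd (hbar μ ν : ℝ) (Φ Ψ : ℝ → ℝ → ℤ → ℂ) : ℝ → ℝ → ℤ → ℂ :=
  fun x y p => ∑' q : ℤ,
    Φ (x - hbar * ((q : ℝ) - (p : ℝ)) * μ) (y - hbar * ((q : ℝ) - (p : ℝ)) * ν) q *
      Ψ (x - hbar * (q : ℝ) * μ) (y - hbar * (q : ℝ) * ν) (p - q)

/-- The involution `Φ*(x,y,p) = conj (Φ(x,y,-p))`. -/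
def invol (Φ : ℝ → ℝ → ℤ → ℂ) : ℝ → ℝ → ℤ → ℂ :=
  fun x y p => starRingEnd ℂ (Φ x y (-p))

/-- The group multiplication on `G = ℝ³`: `(r,s,t)(r',s',t') = (r+r', s+s', t+t'+csr')`. -/
def heisMul (c : ℕ) (g h : ℝ × ℝ × ℝ) : ℝ × ℝ × ℝ :=
  (g.1 + h.1, g.2.1 + h.2.1, g.2.2 + h.2.2 + (c : ℝ) * g.2.1 * h.1)

/-- The action of `G = ℝ³` on `S^c`. -/
def Lact (c : ℕ) (g : ℝ × ℝ × ℝ) (Φ : ℝ → ℝ → ℤ → ℂ) : ℝ → ℝ → ℤ → ℂ :=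
  fun x y p =>
    expi ((p : ℝ) * (g.2.2 + (c : ℝ) * g.2.1 * (x - g.1))) * Φ (x - g.1) (y - g.2.1) p

/-- The trace `τ(Φ) = ∫₀¹ ∫_𝕋 Φ(x,y,0) dy dx`. -/
def tauQHM (Φ : ℝ → ℝ → ℤ → ℂ) : ℂ := ∫ x in (0:ℝ)..1, ∫ y in (0:ℝ)..1, Φ x y 0

/-- The derivation `d₁(Φ) = -∂Φ/∂x`. -/
def d1 (Φ : ℝ → ℝ → ℤ → ℂ) : ℝ → ℝ → ℤ → ℂ :=
  fun x y p => - deriv (fun x' => Φ x' y p) x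

/-- The derivation `d₂(Φ)(x,y,p) = 2πicpx·Φ(x,y,p) - ∂Φ/∂y(x,y,p)`. -/
def d2 (c : ℕ) (Φ : ℝ → ℝ → ℤ → ℂ) : ℝ → ℝ → ℤ → ℂ :=
  fun x y p => ((2 * Real.pi * (c : ℝ) * (p : ℝ) * x : ℝ) : ℂ) * Complex.I * Φ x y p -
    deriv (fun y' => Φ x y' p) y

/-- The derivation `d₃(Φ)(x,y,p) = 2πipcα·Φ(x,y,p)`. -/
def d3 (c : ℕ) (α : ℝ) (Φ : ℝ → ℝ → ℤ → ℂ) : ℝ → ℝ → ℤ → ℂ :=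
  fun x y p => ((2 * Real.pi * (p : ℝ) * (c : ℝ) * α : ℝ) : ℂ) * Complex.I * Φ x y p

/-- The measure on `ℝ × 𝕋 × ℤ`, the torus being identified with `[0,1)`:
Lebesgue measure on `ℝ`, Lebesgue measure restricted to `[0,1)`, and
counting measure on `ℤ`. -/
def μQHM : Measure (ℝ × ℝ × ℤ) :=
  (volume : Measure ℝ).prod
    (((volume : Measure ℝ).restrict (Set.Ico (0:ℝ) 1)).prod Measure.count)

/-- `RepOf hbar μ ν Φ T` says that the bounded operator `T` on `L²(ℝ × 𝕋 × ℤ)` is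
given by the formula `(π(Φ)ξ)(x,y,p) = Σ_q Φ(x-hbar(q-2p)μ, y-hbar(q-2p)ν, q) ξ(x,y,p-q)`. -/
def RepOf (hbar μ ν : ℝ) (Φ : ℝ → ℝ → ℤ → ℂ) (T : Lp ℂ 2 μQHM →L[ℂ] Lp ℂ 2 μQHM) : Prop :=
  ∀ ξ : Lp ℂ 2 μQHM,
    (T ξ : ℝ × ℝ × ℤ → ℂ) =ᵐ[μQHM]
      fun w => ∑' q : ℤ,
        Φ (w.1 - hbar * ((q : ℝ) - 2 * (w.2.2 : ℝ)) * μ)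
            (w.2.1 - hbar * ((q : ℝ) - 2 * (w.2.2 : ℝ)) * ν) q *
          (ξ : ℝ × ℝ × ℤ → ℂ) (w.1, w.2.1, w.2.2 - q)

/-! ### Smooth functions of two variables and their partial derivatives -/

/-- Joint smoothness of a function of two real variables. -/
def Sm (f : ℝ → ℝ → ℂ) : Prop := ContDiff ℝ (⊤ : ℕ∞) (fun xy : ℝ × ℝ => f xy.1 xy.2)

theorem Sm.diff {f : ℝ → ℝ → ℂ} (hf : Sm f) :
    Differentiable ℝ (fun xy : ℝ × ℝ => f xy.1 xy.2) :=
  ContDiff.differentiable hf (by simp)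

theorem Sm.hasX {f : ℝ → ℝ → ℂ} (hf : Sm f) (x y : ℝ) :
    HasDerivAt (fun x' => f x' y)
      (fderiv ℝ (fun xy : ℝ × ℝ => f xy.1 xy.2) (x, y) (1, 0)) x := by
  have h1 := (hf.diff (x, y)).hasFDerivAt
  have h2 : HasDerivAt (fun x' : ℝ => ((x', y) : ℝ × ℝ)) (1, 0) x :=
    (hasDerivAt_id x).prodMk (hasDerivAt_const x y)
  exact HasFDerivAt.comp_hasDerivAt (f := fun x' : ℝ => ((x', y) : ℝ × ℝ)) x h1 h2

theorem Sm.hasY {f : ℝ → ℝ → ℂ} (hf : Sm f) (x y : ℝ) :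
    HasDerivAt (fun y' => f x y')
      (fderiv ℝ (fun xy : ℝ × ℝ => f xy.1 xy.2) (x, y) (0, 1)) y := by
  have h1 := (hf.diff (x, y)).hasFDerivAt
  have h2 : HasDerivAt (fun y' : ℝ => ((x, y') : ℝ × ℝ)) (0, 1) y :=
    (hasDerivAt_const y x).prodMk (hasDerivAt_id y)
  exact HasFDerivAt.comp_hasDerivAt (f := fun y' : ℝ => ((x, y') : ℝ × ℝ)) y h1 h2

theorem Sm.hasPdX {f : ℝ → ℝ → ℂ} (hf : Sm f) (x y : ℝ) :
    HasDerivAt (fun x' => f x' y) (pdX f x y) x :=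
  (hf.hasX x y).differentiableAt.hasDerivAt

theorem Sm.hasPdY {f : ℝ → ℝ → ℂ} (hf : Sm f) (x y : ℝ) :
    HasDerivAt (fun y' => f x y') (pdY f x y) y :=
  (hf.hasY x y).differentiableAt.hasDerivAt

theorem Sm.pdX_eq {f : ℝ → ℝ → ℂ} (hf : Sm f) (x y : ℝ) :
    pdX f x y = fderiv ℝ (fun xy : ℝ × ℝ => f xy.1 xy.2) (x, y) (1, 0) := (hf.hasX x y).deriv

theorem Sm.pdY_eq {f : ℝ → ℝ → ℂ} (hf : Sm f) (x y : ℝ) :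
    pdY f x y = fderiv ℝ (fun xy : ℝ × ℝ => f xy.1 xy.2) (x, y) (0, 1) := (hf.hasY x y).deriv

theorem Sm.smFderiv {f : ℝ → ℝ → ℂ} (hf : Sm f) :
    ContDiff ℝ (⊤ : ℕ∞) (fderiv ℝ (fun xy : ℝ × ℝ => f xy.1 xy.2)) :=
  ContDiff.fderiv_right hf (by simp)

theorem Sm.pdX {f : ℝ → ℝ → ℂ} (hf : Sm f) : Sm (pdX f) := by
  have : (fun xy : ℝ × ℝ => _root_.pdX f xy.1 xy.2) =
      fun xy => fderiv ℝ (fun xy : ℝ × ℝ => f xy.1 xy.2) xy (1, 0) := by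
    funext xy; exact hf.pdX_eq xy.1 xy.2
  unfold Sm
  rw [this]
  exact hf.smFderiv.clm_apply contDiff_const

theorem Sm.pdY {f : ℝ → ℝ → ℂ} (hf : Sm f) : Sm (pdY f) := by
  have : (fun xy : ℝ × ℝ => _root_.pdY f xy.1 xy.2) =
      fun xy => fderiv ℝ (fun xy : ℝ × ℝ => f xy.1 xy.2) xy (0, 1) := by
    funext xy; exact hf.pdY_eq xy.1 xy.2
  unfold Sm
  rw [this]
  exact hf.smFderiv.clm_apply contDiff_const

theorem Sm.pdX_iter {f : ℝ → ℝ → ℂ} (hf : Sm f) (m : ℕ) : Sm (_root_.pdX^[m] f) := by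
  induction m with
  | zero => exact hf
  | succ m ih => rw [Function.iterate_succ_apply']; exact ih.pdX

theorem Sm.pdY_iter {f : ℝ → ℝ → ℂ} (hf : Sm f) (m : ℕ) : Sm (_root_.pdY^[m] f) := by
  induction m with
  | zero => exact hf
  | succ m ih => rw [Function.iterate_succ_apply']; exact ih.pdY

theorem Sm.comm {f : ℝ → ℝ → ℂ} (hf : Sm f) :
    _root_.pdY (_root_.pdX f) = _root_.pdX (_root_.pdY f) := by
  funext x y
  rw [hf.pdX.pdY_eq, hf.pdY.pdX_eq]
  have e1 : (fun xy : ℝ × ℝ => _root_.pdX f xy.1 xy.2) =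
      fun xy => fderiv ℝ (fun xy : ℝ × ℝ => f xy.1 xy.2) xy (1, 0) := by
    funext xy; exact hf.pdX_eq xy.1 xy.2
  have e2 : (fun xy : ℝ × ℝ => _root_.pdY f xy.1 xy.2) =
      fun xy => fderiv ℝ (fun xy : ℝ × ℝ => f xy.1 xy.2) xy (0, 1) := by
    funext xy; exact hf.pdY_eq xy.1 xy.2
  have hd : DifferentiableAt ℝ (fderiv ℝ (fun xy : ℝ × ℝ => f xy.1 xy.2)) (x, y) :=
    (hf.smFderiv.differentiable (by simp)) (x, y)
  have hs : IsSymmSndFDerivAt ℝ (fun xy : ℝ × ℝ => f xy.1 xy.2) (x, y) :=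
    ContDiffAt.isSymmSndFDerivAt (ContDiff.contDiffAt hf) (by
      rw [minSmoothness_of_isRCLikeNormedField]
      exact WithTop.coe_le_coe.2 (le_top : (2 : ℕ∞) ≤ ⊤))
  rw [e1, e2, fderiv_clm_apply hd (by fun_prop), fderiv_clm_apply hd (by fun_prop)]
  simpa using hs (0, 1) (1, 0)

theorem Sm.pdY_iter_pdX {f : ℝ → ℝ → ℂ} (hf : Sm f) (n : ℕ) :
    _root_.pdY^[n] (_root_.pdX f) = _root_.pdX (_root_.pdY^[n] f) := by
  induction n with
  | zero => rfl
  | succ n ih => rw [Function.iterate_succ_apply', Function.iterate_succ_apply', ih,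
      (hf.pdY_iter n).comm]

theorem Sm.lin {f g : ℝ → ℝ → ℂ} (hf : Sm f) (hg : Sm g) (a b : ℂ) :
    Sm (fun x y => a * f x y + b * g x y) :=
  ContDiff.add (ContDiff.mul contDiff_const hf) (ContDiff.mul contDiff_const hg)

theorem pdX_lin {f g : ℝ → ℝ → ℂ} (hf : Sm f) (hg : Sm g) (a b : ℂ) :
    pdX (fun x y => a * f x y + b * g x y) = fun x y => a * pdX f x y + b * pdX g x y := by
  funext x y
  exact (((hf.hasPdX x y).const_mul a).add ((hg.hasPdX x y).const_mul b)).deriv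

theorem pdY_lin {f g : ℝ → ℝ → ℂ} (hf : Sm f) (hg : Sm g) (a b : ℂ) :
    pdY (fun x y => a * f x y + b * g x y) = fun x y => a * pdY f x y + b * pdY g x y := by
  funext x y
  exact (((hf.hasPdY x y).const_mul a).add ((hg.hasPdY x y).const_mul b)).deriv

theorem pdX_iter_lin {f g : ℝ → ℝ → ℂ} (hf : Sm f) (hg : Sm g) (a b : ℂ) (m : ℕ) :
    pdX^[m] (fun x y => a * f x y + b * g x y) =
      fun x y => a * pdX^[m] f x y + b * pdX^[m] g x y := by
  induction m with
  | zero => rfl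
  | succ m ih => rw [Function.iterate_succ_apply', ih, pdX_lin (hf.pdX_iter m) (hg.pdX_iter m),
      Function.iterate_succ_apply', Function.iterate_succ_apply']

theorem pdY_iter_lin {f g : ℝ → ℝ → ℂ} (hf : Sm f) (hg : Sm g) (a b : ℂ) (m : ℕ) :
    pdY^[m] (fun x y => a * f x y + b * g x y) =
      fun x y => a * pdY^[m] f x y + b * pdY^[m] g x y := by
  induction m with
  | zero => rfl
  | succ m ih => rw [Function.iterate_succ_apply', ih, pdY_lin (hf.pdY_iter m) (hg.pdY_iter m),
      Function.iterate_succ_apply', Function.iterate_succ_apply']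

theorem Sm.mulx {f : ℝ → ℝ → ℂ} (hf : Sm f) : Sm (fun x y => (x : ℂ) * f x y) :=
  ContDiff.mul (Complex.ofRealCLM.contDiff.comp contDiff_fst) hf

theorem pdX_mulx {f : ℝ → ℝ → ℂ} (hf : Sm f) :
    pdX (fun x y => (x : ℂ) * f x y) = fun x y => f x y + (x : ℂ) * pdX f x y := by
  funext x y
  have h := ((hasDerivAt_id x).ofReal_comp).mul (hf.hasPdX x y)
  have h' := h.congr_deriv (g' := f x y + (x : ℂ) * pdX f x y) (by simp)
  exact h'.deriv

theorem pdY_iter_mulx {f : ℝ → ℝ → ℂ} (hf : Sm f) (n : ℕ) :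
    pdY^[n] (fun x y => (x : ℂ) * f x y) = fun (x y : ℝ) => (x : ℂ) * pdY^[n] f x y := by
  induction n with
  | zero => rfl
  | succ n ih =>
    rw [Function.iterate_succ_apply', ih, Function.iterate_succ_apply']
    funext x y
    exact (((hf.pdY_iter n).hasPdY x y).const_mul (x : ℂ)).deriv

theorem pdX_iter_mulx {f : ℝ → ℝ → ℂ} (hf : Sm f) (m : ℕ) :
    pdX^[m] (fun x y => (x : ℂ) * f x y) =
      fun (x y : ℝ) => (x : ℂ) * pdX^[m] f x y + (m : ℂ) * pdX^[m - 1] f x y := by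
  induction m with
  | zero => funext x y; simp
  | succ m ih =>
    rw [Function.iterate_succ_apply', ih]
    have h1 := pdX_lin (hf.pdX_iter m).mulx (hf.pdX_iter (m - 1)) 1 (m : ℂ)
    simp only [one_mul] at h1
    rw [h1, pdX_mulx (hf.pdX_iter m)]
    funext x y
    simp only [Nat.add_sub_cancel]
    rw [Function.iterate_succ_apply']
    rcases m with _ | m
    · simp; ring
    · simp only [Nat.add_sub_cancel, ← Function.iterate_succ_apply' (f := pdX)]
      push_cast; ring

/-! ### Closure properties of the Schwartz-type bounds -/

/-- The Schwartz-type bounds in `IsSc`. -/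
def Bd (Φ : ℝ → ℝ → ℤ → ℂ) : Prop :=
  ∀ (P : Polynomial ℤ) (m n : ℕ) (K : Set (ℝ × ℝ)), IsCompact K →
    ∃ C : ℝ, ∀ (x y : ℝ) (p : ℤ), (x, y) ∈ K →
      ‖((P.eval p : ℤ) : ℂ) * pdX^[m] (pdY^[n] (fun x' y' => Φ x' y' p)) x y‖ ≤ C

theorem Bd.lin {F G : ℝ → ℝ → ℤ → ℂ} (hF : Bd F) (hG : Bd G)
    (sF : ∀ p, Sm (fun x y => F x y p)) (sG : ∀ p, Sm (fun x y => G x y p)) (a b : ℂ) :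
    Bd (fun x y p => a * F x y p + b * G x y p) := by
  intro P m n K hK
  obtain ⟨C, hC⟩ := hF P m n K hK
  obtain ⟨D, hD⟩ := hG P m n K hK
  refine ⟨‖a‖ * C + ‖b‖ * D, fun x y p h => ?_⟩
  rw [pdY_iter_lin (sF p) (sG p), pdX_iter_lin ((sF p).pdY_iter n) ((sG p).pdY_iter n)]
  have e : ∀ t u v : ℂ, t * (a * u + b * v) = a * (t * u) + b * (t * v) := by intros; ring
  rw [e]
  refine (norm_add_le _ _).trans ?_
  rw [norm_mul a, norm_mul b]
  exact add_le_add (mul_le_mul_of_nonneg_left (hC x y p h) (norm_nonneg _))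
    (mul_le_mul_of_nonneg_left (hD x y p h) (norm_nonneg _))

theorem Bd.mulp {F : ℝ → ℝ → ℤ → ℂ} (hF : Bd F) (sF : ∀ p, Sm (fun x y => F x y p)) :
    Bd (fun x y p => (p : ℂ) * F x y p) := by
  intro P m n K hK
  obtain ⟨C, hC⟩ := hF (P * Polynomial.X) m n K hK
  refine ⟨C, fun x y p h => ?_⟩
  have e := pdY_iter_lin (sF p) (sF p) (p : ℂ) 0 n
  have e' := pdX_iter_lin ((sF p).pdY_iter n) ((sF p).pdY_iter n) (p : ℂ) 0 m
  simp only [zero_mul, add_zero] at e e'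
  rw [e, e', ← mul_assoc]
  simpa using hC x y p h

theorem Bd.mulx {F : ℝ → ℝ → ℤ → ℂ} (hF : Bd F) (sF : ∀ p, Sm (fun x y => F x y p)) :
    Bd (fun x y p => (x : ℂ) * F x y p) := by
  intro P m n K hK
  obtain ⟨C, hC⟩ := hF P m n K hK
  obtain ⟨D, hD⟩ := hF P (m - 1) n K hK
  obtain ⟨R, hR⟩ := hK.isBounded.exists_norm_le
  refine ⟨R * C + m * D, fun x y p h => ?_⟩
  rw [pdY_iter_mulx (sF p), pdX_iter_mulx ((sF p).pdY_iter n)]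
  have e : ∀ t u v w z : ℂ, t * (u * v + w * z) = u * (t * v) + w * (t * z) := by intros; ring
  rw [e]
  refine (norm_add_le _ _).trans ?_
  rw [norm_mul (x : ℂ), norm_mul (m : ℂ)]
  have hx : ‖(x : ℂ)‖ ≤ R := by
    rw [Complex.norm_real]; exact (norm_fst_le (x, y)).trans (hR _ h)
  have h1 := hC x y p h
  have h2 := hD x y p h
  refine add_le_add (mul_le_mul hx h1 (norm_nonneg _) ((norm_nonneg _).trans hx)) ?_
  rw [Complex.norm_natCast]
  exact mul_le_mul_of_nonneg_left h2 (Nat.cast_nonneg _)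

theorem Bd.px {F : ℝ → ℝ → ℤ → ℂ} (hF : Bd F) (sF : ∀ p, Sm (fun x y => F x y p)) :
    Bd (fun x y p => pdX (fun x y => F x y p) x y) := by
  intro P m n K hK
  obtain ⟨C, hC⟩ := hF P (m + 1) n K hK
  refine ⟨C, fun x y p h => ?_⟩
  have := (sF p).pdY_iter_pdX n
  rw [show (fun x' y' => pdX (fun x y => F x y p) x' y') = pdX (fun x y => F x y p) from rfl,
    this, ← Function.iterate_succ_apply]
  exact hC x y p h

theorem Bd.py {F : ℝ → ℝ → ℤ → ℂ} (hF : Bd F) :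
    Bd (fun x y p => pdY (fun x y => F x y p) x y) := by
  intro P m n K hK
  obtain ⟨C, hC⟩ := hF P m (n + 1) K hK
  refine ⟨C, fun x y p h => ?_⟩
  rw [show (fun x' y' => pdY (fun x y => F x y p) x' y') = pdY (fun x y => F x y p) from rfl,
    ← Function.iterate_succ_apply]
  exact hC x y p h

/-! ### The maps preserve `S^c` -/

theorem expi_hasDerivAt (a y : ℝ) :
    HasDerivAt (fun y : ℝ => expi (a * y)) (2 * Real.pi * Complex.I * a * expi (a * y)) y := by
  unfold expi
  have h : HasDerivAt (fun y : ℝ => 2 * Real.pi * Complex.I * ((a * y : ℝ) : ℂ))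
      (2 * Real.pi * Complex.I * a) y := by
    have := (((hasDerivAt_id y).const_mul a).ofReal_comp).const_mul (2 * Real.pi * Complex.I)
    simpa using this
  have := h.cexp
  convert this using 1
  ring

theorem isSc_d1 {c : ℕ} {Φ : ℝ → ℝ → ℤ → ℂ} (h : IsSc c Φ) : IsSc c (d1 Φ) := by
  obtain ⟨s, hy, hx, b⟩ := h
  have s' : ∀ p, Sm (fun x y => Φ x y p) := s
  have e : d1 Φ = fun x y p => (-1) * pdX (fun x y => Φ x y p) x y
      + 0 * pdX (fun x y => Φ x y p) x y := by
    funext x y p; simp [d1, pdX]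
  refine ⟨?_, ?_, ?_, ?_⟩
  · intro p
    rw [e]
    exact (s' p).pdX.lin (s' p).pdX _ _
  · intro x y p
    simp only [d1, hy]
  · intro k x y p
    have h1 : deriv (fun x' => Φ x' y p) (x + k) = deriv (fun x' => Φ (x' + k) y p) x :=
      (deriv_comp_add_const (fun x' => Φ x' y p) (k : ℝ) x).symm
    simp only [d1]
    rw [h1]
    simp only [hx]
    have h2 := (((s' p).hasPdX x y).const_mul (expi (c * k * p * y))).deriv
    rw [h2, pdX]; ring
  · rw [e]
    exact Bd.lin (Bd.px b s') (Bd.px b s') (fun p => (s' p).pdX) (fun p => (s' p).pdX) _ _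

theorem isSc_d2 {c : ℕ} {Φ : ℝ → ℝ → ℤ → ℂ} (h : IsSc c Φ) : IsSc c (d2 c Φ) := by
  obtain ⟨s, hy, hx, b⟩ := h
  have s' : ∀ p, Sm (fun x y => Φ x y p) := s
  have e : d2 c Φ = fun (x y : ℝ) (p : ℤ) => (2 * Real.pi * c * Complex.I) * ((p : ℂ) * ((x : ℂ) * Φ x y p))
      + (-1) * pdY (fun x y => Φ x y p) x y := by
    funext x y p; simp [d2, pdY]; ring
  have sp : ∀ p : ℤ, Sm (fun x y => (p : ℂ) * ((x : ℂ) * Φ x y p)) := fun p => by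
    have := (s' p).mulx.lin (s' p).mulx (p : ℂ) 0
    simpa using this
  refine ⟨?_, ?_, ?_, ?_⟩
  · intro p
    rw [e]
    exact (sp p).lin (s' p).pdY _ _
  · intro x y p
    have h1 : deriv (fun y' => Φ x y' p) (y + 1) = deriv (fun y' => Φ x (y' + 1) p) y :=
      (deriv_comp_add_const (fun y' => Φ x y' p) (1 : ℝ) y).symm
    simp only [d2]
    rw [h1]
    simp only [hy]
  · intro k x y p
    simp only [d2, hx]
    have h2 := ((expi_hasDerivAt (c * k * p) y).mul ((s' p).hasPdY x y)).deriv
    have h3 : deriv (fun y' => expi (c * k * p * y') * Φ x y' p) y = _ := h2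
    rw [h3, pdY]; push_cast; ring
  · rw [e]
    exact Bd.lin (Bd.mulp (Bd.mulx b s') (fun p => (s' p).mulx)) (Bd.py b) sp
      (fun p => (s' p).pdY) _ _

theorem isSc_d3 {c : ℕ} {α : ℝ} {Φ : ℝ → ℝ → ℤ → ℂ} (h : IsSc c Φ) : IsSc c (d3 c α Φ) := by
  obtain ⟨s, hy, hx, b⟩ := h
  have s' : ∀ p, Sm (fun x y => Φ x y p) := s
  have e : d3 c α Φ = fun (x y : ℝ) (p : ℤ) => (2 * Real.pi * c * α * Complex.I) * ((p : ℂ) * Φ x y p)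
      + 0 * Φ x y p := by
    funext x y p; simp [d3]; ring
  have sp : ∀ p : ℤ, Sm (fun x y => (p : ℂ) * Φ x y p) := fun p => by
    have := (s' p).lin (s' p) (p : ℂ) 0
    simpa using this
  refine ⟨?_, ?_, ?_, ?_⟩
  · intro p
    rw [e]
    exact (sp p).lin (s' p) _ _
  · intro x y p
    simp only [d3, hy]
  · intro k x y p
    simp only [d3, hx]; ring
  · rw [e]
    exact Bd.lin (Bd.mulp b s') b sp s' _ _

/-! ### Summability of the product -/

theorem expi_norm (x : ℝ) : ‖expi x‖ = 1 := by
  unfold expi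
  rw [show (2 * Real.pi * Complex.I * x : ℂ) = ((2 * Real.pi * x : ℝ) : ℂ) * Complex.I by
    push_cast; ring]
  exact Complex.norm_exp_ofReal_mul_I _

/-- Elements of `S^c` decay rapidly in `p`, uniformly on all of `ℝ × 𝕋`. -/
theorem IsSc.unif {c : ℕ} {Φ : ℝ → ℝ → ℤ → ℂ} (h : IsSc c Φ) (P : Polynomial ℤ) :
    ∃ C : ℝ, ∀ (x y : ℝ) (p : ℤ), ‖((P.eval p : ℤ) : ℂ) * Φ x y p‖ ≤ C := by
  obtain ⟨s, hy, hx, b⟩ := h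
  obtain ⟨C, hC⟩ := b P 0 0 (Set.Icc 0 1 ×ˢ Set.Icc 0 1) (isCompact_Icc.prod isCompact_Icc)
  refine ⟨C, fun x y p => ?_⟩
  have h1 : Φ x y p = Φ x (Int.fract y) p := by
    have hp : Function.Periodic (fun y => Φ x y p) 1 := fun y => hy x y p
    have := hp.sub_int_mul_eq ⌊y⌋ (x := y)
    rw [mul_one] at this
    exact this.symm
  have h2 : ‖Φ x (Int.fract y) p‖ = ‖Φ (Int.fract x) (Int.fract y) p‖ := by
    have := hx ⌊x⌋ (Int.fract x) (Int.fract y) p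
    rw [Int.fract_add_floor] at this
    rw [this, norm_mul, expi_norm, one_mul]
  rw [norm_mul, h1, h2, ← norm_mul]
  exact hC _ _ p ⟨⟨Int.fract_nonneg _, (Int.fract_lt_one _).le⟩,
    ⟨Int.fract_nonneg _, (Int.fract_lt_one _).le⟩⟩

/-- The general term of the series defining the product. -/
def term (hbar μ ν : ℝ) (Φ Ψ : ℝ → ℝ → ℤ → ℂ) (x y : ℝ) (p q : ℤ) : ℂ :=
  Φ (x - hbar * ((q : ℝ) - (p : ℝ)) * μ) (y - hbar * ((q : ℝ) - (p : ℝ)) * ν) q *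
      Ψ (x - hbar * (q : ℝ) * μ) (y - hbar * (q : ℝ) * ν) (p - q)

theorem starProd_eq (hbar μ ν : ℝ) (Φ Ψ : ℝ → ℝ → ℤ → ℂ) (x y : ℝ) (p : ℤ) :
    starProd hbar μ ν Φ Ψ x y p = ∑' q : ℤ, term hbar μ ν Φ Ψ x y p q := rfl

theorem term_bound {c : ℕ} {Φ Ψ : ℝ → ℝ → ℤ → ℂ} (hΦ : IsSc c Φ) (hΨ : IsSc c Ψ)
    (hbar μ ν : ℝ) : ∃ u : ℤ → ℝ, Summable u ∧
      ∀ x y p q, ‖term hbar μ ν Φ Ψ x y p q‖ ≤ u q := by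
  obtain ⟨C, hC⟩ := hΦ.unif (1 + Polynomial.X ^ 2)
  obtain ⟨D, hD⟩ := hΨ.unif 1
  have hsum : Summable (fun q : ℤ => (1 + (q : ℝ) ^ 2)⁻¹) := by
    refine Summable.of_norm_bounded_eventually
      (g := fun q : ℤ => 1 / (q : ℝ) ^ 2)
      ((Real.summable_one_div_int_pow (p := 2)).2 (by norm_num)) ?_
    rw [Filter.eventually_cofinite]
    refine (Set.finite_singleton (0 : ℤ)).subset ?_
    intro q hq
    by_contra h0
    apply hq
    have hq0 : (0 : ℝ) < (q : ℝ) ^ 2 := by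
      have : (q : ℝ) ≠ 0 := by exact_mod_cast h0
      positivity
    rw [Real.norm_of_nonneg (by positivity), one_div]
    exact inv_anti₀ hq0 (by linarith)
  refine ⟨fun q => C * D * (1 + (q : ℝ) ^ 2)⁻¹, hsum.mul_left _, fun x y p q => ?_⟩
  have h1 := hC (x - hbar * ((q : ℝ) - (p : ℝ)) * μ) (y - hbar * ((q : ℝ) - (p : ℝ)) * ν) q
  have h2 := hD (x - hbar * (q : ℝ) * μ) (y - hbar * (q : ℝ) * ν) (p - q)
  have hn : ‖(((1 + Polynomial.X ^ 2 : Polynomial ℤ).eval q : ℤ) : ℂ)‖ = 1 + (q : ℝ) ^ 2 := by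
    have : (((1 + Polynomial.X ^ 2 : Polynomial ℤ).eval q : ℤ) : ℂ)
        = ((1 + (q : ℝ) ^ 2 : ℝ) : ℂ) := by simp
    rw [this, Complex.norm_real, Real.norm_of_nonneg (by positivity)]
  rw [norm_mul, hn] at h1
  simp only [Polynomial.eval_one, Int.cast_one, one_mul] at h2
  have hpos : (0 : ℝ) < 1 + (q : ℝ) ^ 2 := by positivity
  unfold term
  beta_reduce
  rw [norm_mul, ← div_eq_mul_inv, le_div_iff₀ hpos]
  calc _ = ((1 + (q : ℝ) ^ 2) * ‖Φ (x - hbar * ((q : ℝ) - (p : ℝ)) * μ)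
            (y - hbar * ((q : ℝ) - (p : ℝ)) * ν) q‖) *
          ‖Ψ (x - hbar * (q : ℝ) * μ) (y - hbar * (q : ℝ) * ν) (p - q)‖ := by ring
    _ ≤ C * D := mul_le_mul h1 h2 (norm_nonneg _) ((by positivity : (0:ℝ) ≤ _).trans h1)

theorem term_summable {c : ℕ} {Φ Ψ : ℝ → ℝ → ℤ → ℂ} (hΦ : IsSc c Φ) (hΨ : IsSc c Ψ)
    (hbar μ ν x y : ℝ) (p : ℤ) : Summable (fun q => term hbar μ ν Φ Ψ x y p q) := by
  obtain ⟨u, hu, h⟩ := term_bound hΦ hΨ hbar μ ν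
  exact Summable.of_norm_bounded hu (fun q => h x y p q)

theorem IsSc.sm {c : ℕ} {Φ : ℝ → ℝ → ℤ → ℂ} (h : IsSc c Φ) (p : ℤ) :
    Sm (fun x y => Φ x y p) := h.1 p

theorem term_hasX {c : ℕ} {Φ Ψ : ℝ → ℝ → ℤ → ℂ} (hΦ : IsSc c Φ) (hΨ : IsSc c Ψ)
    (hbar μ ν x y : ℝ) (p q : ℤ) :
    HasDerivAt (fun x => term hbar μ ν Φ Ψ x y p q)
      (-(term hbar μ ν (d1 Φ) Ψ x y p q + term hbar μ ν Φ (d1 Ψ) x y p q)) x := by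
  have h1 := ((hΦ.sm q).hasPdX (x - hbar * ((q : ℝ) - (p : ℝ)) * μ)
    (y - hbar * ((q : ℝ) - (p : ℝ)) * ν)).comp_sub_const x _
  have h2 := ((hΨ.sm (p - q)).hasPdX (x - hbar * (q : ℝ) * μ)
    (y - hbar * (q : ℝ) * ν)).comp_sub_const x _
  refine (h1.mul h2).congr_deriv ?_
  simp only [term, d1, pdX]
  ring

theorem term_hasY {c : ℕ} {Φ Ψ : ℝ → ℝ → ℤ → ℂ} (hΦ : IsSc c Φ) (hΨ : IsSc c Ψ)
    (hbar μ ν x y : ℝ) (p q : ℤ) :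
    HasDerivAt (fun y => term hbar μ ν Φ Ψ x y p q)
      (((2 * Real.pi * (c : ℝ) * (p : ℝ) * x : ℝ) : ℂ) * Complex.I * term hbar μ ν Φ Ψ x y p q
        - (term hbar μ ν (d2 c Φ) Ψ x y p q + term hbar μ ν Φ (d2 c Ψ) x y p q)) y := by
  have h1 := ((hΦ.sm q).hasPdY (x - hbar * ((q : ℝ) - (p : ℝ)) * μ)
    (y - hbar * ((q : ℝ) - (p : ℝ)) * ν)).comp_sub_const y _
  have h2 := ((hΨ.sm (p - q)).hasPdY (x - hbar * (q : ℝ) * μ)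
    (y - hbar * (q : ℝ) * ν)).comp_sub_const y _
  refine (h1.mul h2).congr_deriv ?_
  simp only [term, d2, pdY]
  push_cast
  ring

theorem star_d1 {c : ℕ} {Φ Ψ : ℝ → ℝ → ℤ → ℂ} (hΦ : IsSc c Φ) (hΨ : IsSc c Ψ)
    (hbar μ ν x y : ℝ) (p : ℤ) :
    d1 (starProd hbar μ ν Φ Ψ) x y p =
      starProd hbar μ ν (d1 Φ) Ψ x y p + starProd hbar μ ν Φ (d1 Ψ) x y p := by
  obtain ⟨u, hu, h⟩ := term_bound (isSc_d1 hΦ) hΨ hbar μ ν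
  obtain ⟨v, hv, h'⟩ := term_bound hΦ (isSc_d1 hΨ) hbar μ ν
  have key := hasDerivAt_tsum (hu.add hv)
    (fun q x => term_hasX hΦ hΨ hbar μ ν x y p q)
    (fun q x => by
      rw [norm_neg]
      exact (norm_add_le _ _).trans (add_le_add (h x y p q) (h' x y p q)))
    (term_summable hΦ hΨ hbar μ ν x y p) x
  have : d1 (starProd hbar μ ν Φ Ψ) x y p = - _ := congrArg Neg.neg key.deriv
  rw [this, tsum_neg, neg_neg, Summable.tsum_add (term_summable (isSc_d1 hΦ) hΨ hbar μ ν x y p)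
    (term_summable hΦ (isSc_d1 hΨ) hbar μ ν x y p)]
  rfl

theorem star_d2 {c : ℕ} {Φ Ψ : ℝ → ℝ → ℤ → ℂ} (hΦ : IsSc c Φ) (hΨ : IsSc c Ψ)
    (hbar μ ν x y : ℝ) (p : ℤ) :
    d2 c (starProd hbar μ ν Φ Ψ) x y p =
      starProd hbar μ ν (d2 c Φ) Ψ x y p + starProd hbar μ ν Φ (d2 c Ψ) x y p := by
  obtain ⟨w, hw, h0⟩ := term_bound hΦ hΨ hbar μ ν
  obtain ⟨u, hu, h⟩ := term_bound (isSc_d2 hΦ) hΨ hbar μ ν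
  obtain ⟨v, hv, h'⟩ := term_bound hΦ (isSc_d2 hΨ) hbar μ ν
  set a : ℂ := ((2 * Real.pi * (c : ℝ) * (p : ℝ) * x : ℝ) : ℂ) * Complex.I with ha
  have key := hasDerivAt_tsum ((hw.mul_left ‖a‖).add (hu.add hv))
    (fun q y => term_hasY hΦ hΨ hbar μ ν x y p q)
    (fun q y => by
      refine (norm_sub_le _ _).trans (add_le_add ?_
        ((norm_add_le _ _).trans (add_le_add (h x y p q) (h' x y p q))))
      rw [← ha, norm_mul a]
      exact mul_le_mul_of_nonneg_left (h0 x y p q) (norm_nonneg _))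
    (term_summable hΦ hΨ hbar μ ν x y p) y
  have e : d2 c (starProd hbar μ ν Φ Ψ) x y p = a * starProd hbar μ ν Φ Ψ x y p - _ :=
    congrArg (fun t => a * starProd hbar μ ν Φ Ψ x y p - t) key.deriv
  have s0 := term_summable hΦ hΨ hbar μ ν x y p
  have s1 := term_summable (isSc_d2 hΦ) hΨ hbar μ ν x y p
  have s2 := term_summable hΦ (isSc_d2 hΨ) hbar μ ν x y p
  rw [e, Summable.tsum_sub (s0.mul_left _) (s1.add s2), Summable.tsum_add s1 s2, tsum_mul_left]
  simp only [starProd_eq]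
  ring

theorem star_d3 {c : ℕ} {Φ Ψ : ℝ → ℝ → ℤ → ℂ} (hΦ : IsSc c Φ) (hΨ : IsSc c Ψ)
    (α hbar μ ν x y : ℝ) (p : ℤ) :
    d3 c α (starProd hbar μ ν Φ Ψ) x y p =
      starProd hbar μ ν (d3 c α Φ) Ψ x y p + starProd hbar μ ν Φ (d3 c α Ψ) x y p := by
  have s1 := term_summable (isSc_d3 (α := α) hΦ) hΨ hbar μ ν x y p
  have s2 := term_summable hΦ (isSc_d3 (α := α) hΨ) hbar μ ν x y p
  simp only [starProd_eq]
  rw [← Summable.tsum_add s1 s2]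
  simp only [d3, starProd_eq]
  rw [← tsum_mul_left]
  congr 1
  funext q
  simp only [term, d3]
  push_cast
  ring

/-- each of `d₁, d₂, d₃` maps `S^c` into `S^c` and is a derivation of
`(S^c, ★)`: `d_j(Φ★Ψ) = d_j(Φ)★Ψ + Φ★d_j(Ψ)` for `j = 1,2,3`. -/
theorem d_derivations (c : ℕ) (hc : 0 < c) (α : ℝ) (hα : 1 < α) (hbar μ ν : ℝ)
    (hμν : μ ^ 2 + ν ^ 2 ≠ 0) (Φ Ψ : ℝ → ℝ → ℤ → ℂ) (hΦ : IsSc c Φ) (hΨ : IsSc c Ψ) :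
    (IsSc c (d1 Φ) ∧ IsSc c (d2 c Φ) ∧ IsSc c (d3 c α Φ)) ∧
    (d1 (starProd hbar μ ν Φ Ψ) = fun x y p =>
      starProd hbar μ ν (d1 Φ) Ψ x y p + starProd hbar μ ν Φ (d1 Ψ) x y p) ∧
    (d2 c (starProd hbar μ ν Φ Ψ) = fun x y p =>
      starProd hbar μ ν (d2 c Φ) Ψ x y p + starProd hbar μ ν Φ (d2 c Ψ) x y p) ∧
    (d3 c α (starProd hbar μ ν Φ Ψ) = fun x y p =>
      starProd hbar μ ν (d3 c α Φ) Ψ x y p + starProd hbar μ ν Φ (d3 c α Ψ) x y p) := by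
  exact ⟨⟨isSc_d1 hΦ, isSc_d2 hΦ, isSc_d3 hΦ⟩,
    by funext x y p; exact star_d1 hΦ hΨ hbar μ ν x y p,
    by funext x y p; exact star_d2 hΦ hΨ hbar μ ν x y p,
    by funext x y p; exact star_d3 hΦ hΨ α hbar μ ν x y p⟩
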